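/- There is a bijection between the set of GL₂(ℤ)-equivalence classes of integral binary cubic forms and the set of isomorphism classes of cubic rings, which preserves discriminants (Disc(R(f)) = Disc(f)) and under which a form f is irreducible over ℚ if and only if the corresponding cubic ring R(f) is an integral domain. -/

import Mathlib

open Filter Asymptotics Real

/-- An integral binary cubic form `ax³ + bx²y + cxy² + dy³`, recorded as `(a,b,c,d)`. -/
abbrev BinaryCubic := ℤ × ℤ × ℤ × ℤ

/-- The homogeneous polynomial associated to a binary cubic form over a commutative ring. -/
noncomputable def toPoly {A : Type*} [CommRing A] (f : A × A × A × A) :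
    MvPolynomial (Fin 2) A :=
  MvPolynomial.C f.1 * MvPolynomial.X 0 ^ 3 +
    MvPolynomial.C f.2.1 * MvPolynomial.X 0 ^ 2 * MvPolynomial.X 1 +
    MvPolynomial.C f.2.2.1 * MvPolynomial.X 0 * MvPolynomial.X 1 ^ 2 +
    MvPolynomial.C f.2.2.2 * MvPolynomial.X 1 ^ 3

/-- `ActsTo γ f g` means `g = γ · f` under the twisted action
`(γ · f)(x,y) = (det γ)⁻¹ · f((x,y)·γ)`, expressed without inverses as
`(det γ) · (γ·f)(x,y) = f((x,y)·γ)`. -/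
def ActsTo {A : Type*} [CommRing A] (γ : Matrix (Fin 2) (Fin 2) A)
    (f g : A × A × A × A) : Prop :=
  MvPolynomial.C γ.det * toPoly g =
    MvPolynomial.bind₁
      (fun j : Fin 2 =>
        MvPolynomial.C (γ 0 j) * MvPolynomial.X 0 + MvPolynomial.C (γ 1 j) * MvPolynomial.X 1)
      (toPoly f)

/-- `GL₂(ℤ)`-equivalence of integral binary cubic forms (twisted action). -/
def FormEquiv (f g : BinaryCubic) : Prop :=
  ∃ γ : Matrix (Fin 2) (Fin 2) ℤ, IsUnit γ.det ∧ ActsTo γ f g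

/-- The discriminant of a binary cubic form `(a,b,c,d)`:
`b²c² − 4ac³ − 4b³d − 27a²d² + 18abcd`. -/
def discF (f : BinaryCubic) : ℤ :=
  f.2.1 ^ 2 * f.2.2.1 ^ 2 - 4 * f.1 * f.2.2.1 ^ 3 - 4 * f.2.1 ^ 3 * f.2.2.2 -
    27 * f.1 ^ 2 * f.2.2.2 ^ 2 + 18 * f.1 * f.2.1 * f.2.2.1 * f.2.2.2

/-- Irreducibility of a binary cubic form, as a polynomial over `ℚ`. -/
def IrredForm (f : BinaryCubic) : Prop :=
  Irreducible (MvPolynomial.map (Int.castRingHom ℚ) (toPoly f))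

/-- The number of `GL₂(ℤ)`-equivalence classes of integral binary cubic forms
satisfying a property `P` (assumed `GL₂(ℤ)`-invariant). -/
noncomputable def countClasses (P : BinaryCubic → Prop) : ℕ :=
  Nat.card (Quot fun f g : { f : BinaryCubic // P f } => FormEquiv f.1 g.1)

/-- A cubic ring: a commutative ring with unit whose additive group is `ℤ³`,
given by its multiplication and unit (additive maps `ℤ³ → ℤ³` are automatically
`ℤ`-linear, so this is exactly a commutative ring structure on the free `ℤ`-module
of rank 3). -/
structure CubicRingStruct where
  mul : (Fin 3 → ℤ) → (Fin 3 → ℤ) → (Fin 3 → ℤ)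
  one : Fin 3 → ℤ
  mul_comm : ∀ x y, mul x y = mul y x
  mul_assoc : ∀ x y z, mul (mul x y) z = mul x (mul y z)
  one_mul : ∀ x, mul one x = x
  left_distrib : ∀ x y z, mul x (y + z) = mul x y + mul x z

/-- The trace of multiplication by `x` on a cubic ring. -/
def ringTrace (s : CubicRingStruct) (x : Fin 3 → ℤ) : ℤ :=
  ∑ j : Fin 3, s.mul x (Pi.single j 1) j

/-- The discriminant of a cubic ring: the determinant of the matrix of the trace form
on the standard basis. -/
def ringDisc (s : CubicRingStruct) : ℤ :=
  (Matrix.of fun i j : Fin 3 =>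
    ringTrace s (s.mul (Pi.single i 1) (Pi.single j 1))).det

/-- Isomorphism of cubic rings: an additive bijection preserving one and multiplication. -/
def RingStructIso (s t : CubicRingStruct) : Prop :=
  ∃ φ : (Fin 3 → ℤ) ≃+ (Fin 3 → ℤ),
    φ s.one = t.one ∧ ∀ x y, φ (s.mul x y) = t.mul (φ x) (φ y)

/-- The cubic ring is an integral domain. -/
def IsDomainStruct (s : CubicRingStruct) : Prop :=
  s.one ≠ 0 ∧ ∀ x y, s.mul x y = 0 → x = 0 ∨ y = 0


/-- The value `f(x, y)` of a binary cubic form. -/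
def formEval {A : Type*} [CommRing A] (f : A × A × A × A) (x y : A) : A :=
  f.1 * x ^ 3 + f.2.1 * x ^ 2 * y + f.2.2.1 * x * y ^ 2 + f.2.2.2 * y ^ 3

theorem eval_toPoly {A : Type*} [CommRing A] (f : A × A × A × A) (v : Fin 2 → A) :
    MvPolynomial.eval v (toPoly f) = formEval f (v 0) (v 1) := by
  simp [toPoly, formEval]

theorem actsTo_iff (γ : Matrix (Fin 2) (Fin 2) ℤ) (f g : BinaryCubic) :
    ActsTo γ f g ↔ ∀ x y, γ.det * formEval g x y =
      formEval f (γ 0 0 * x + γ 1 0 * y) (γ 0 1 * x + γ 1 1 * y) := by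
  have key : ∀ v : Fin 2 → ℤ, MvPolynomial.eval v (MvPolynomial.bind₁
      (fun j : Fin 2 => MvPolynomial.C (γ 0 j) * MvPolynomial.X 0 +
        MvPolynomial.C (γ 1 j) * MvPolynomial.X 1) (toPoly f)) =
      formEval f (γ 0 0 * v 0 + γ 1 0 * v 1) (γ 0 1 * v 0 + γ 1 1 * v 1) := by
    intro v
    simp [toPoly, formEval]
  constructor
  · intro h x y
    have := congrArg (MvPolynomial.eval ![x, y]) h
    rw [key, map_mul, eval_toPoly] at this
    simpa using this
  · intro h
    refine MvPolynomial.funext fun v => ?_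
    rw [key, map_mul, eval_toPoly, MvPolynomial.eval_C]
    exact h _ _

theorem formEval_injective {f g : BinaryCubic}
    (h : ∀ x y, formEval f x y = formEval g x y) : f = g := by
  obtain ⟨a, b, c, d⟩ := f
  obtain ⟨a', b', c', d'⟩ := g
  have h1 := h 1 0
  have h2 := h 0 1
  have h3 := h 1 1
  have h4 := h 1 (-1)
  simp only [formEval] at h1 h2 h3 h4
  refine Prod.ext ?_ (Prod.ext ?_ (Prod.ext ?_ ?_)) <;> dsimp only <;> linarith

namespace CubicRingStruct

variable (s : CubicRingStruct)

theorem right_distrib (x y z : Fin 3 → ℤ) : s.mul (x + y) z = s.mul x z + s.mul y z := by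
  rw [s.mul_comm, s.left_distrib, s.mul_comm z x, s.mul_comm z y]

/-- The multiplication of a cubic ring as a bilinear map. -/
def mulLin : (Fin 3 → ℤ) →ₗ[ℤ] (Fin 3 → ℤ) →ₗ[ℤ] (Fin 3 → ℤ) :=
  (AddMonoidHom.toIntLinearMap
    { toFun := fun x => (AddMonoidHom.mk' (s.mul x) (s.left_distrib x)).toIntLinearMap
      map_zero' := by
        ext1 i
        have h := s.right_distrib 0 0
        refine LinearMap.ext_ring ?_
        simpa using h (Pi.single i 1)
      map_add' := fun x y => LinearMap.ext fun z => s.right_distrib x y z })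

@[simp]
theorem mulLin_apply (x y : Fin 3 → ℤ) : s.mulLin x y = s.mul x y := rfl

theorem mul_smul (n : ℤ) (x y : Fin 3 → ℤ) : s.mul x (n • y) = n • s.mul x y :=
  (s.mulLin x).map_smul n y

theorem smul_mul (n : ℤ) (x y : Fin 3 → ℤ) : s.mul (n • x) y = n • s.mul x y :=
  s.mulLin.map_smul₂ n x y

/-- `φ` is an isomorphism of cubic rings from `s` to `t`. -/
def IsIso (s t : CubicRingStruct) (φ : (Fin 3 → ℤ) ≃+ (Fin 3 → ℤ)) : Prop :=
  φ s.one = t.one ∧ ∀ x y, φ (s.mul x y) = t.mul (φ x) (φ y)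

variable {s} {t u : CubicRingStruct} {φ ψ : (Fin 3 → ℤ) ≃+ (Fin 3 → ℤ)}

theorem IsIso.symm (h : IsIso s t φ) : IsIso t s φ.symm := by
  refine ⟨by rw [← h.1, φ.symm_apply_apply], fun x y => ?_⟩
  rw [AddEquiv.symm_apply_eq, h.2, φ.apply_symm_apply, φ.apply_symm_apply]

theorem IsIso.trans (h : IsIso s t φ) (k : IsIso t u ψ) : IsIso s u (φ.trans ψ) :=
  ⟨by simp [h.1, k.1], fun x y => by simp [h.2, k.2]⟩

theorem IsIso.refl (s : CubicRingStruct) : IsIso s s (AddEquiv.refl _) :=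
  ⟨rfl, fun _ _ => rfl⟩

/-- The cubic ring structure obtained from `s` by pulling back along an additive automorphism. -/
def pullback (s : CubicRingStruct) (φ : (Fin 3 → ℤ) ≃+ (Fin 3 → ℤ)) : CubicRingStruct where
  mul x y := φ.symm (s.mul (φ x) (φ y))
  one := φ.symm s.one
  mul_comm x y := by rw [s.mul_comm]
  mul_assoc x y z := by simp [s.mul_assoc]
  one_mul x := by simp [s.one_mul]
  left_distrib x y z := by simp [s.left_distrib]

theorem isIso_pullback (s : CubicRingStruct) (φ : (Fin 3 → ℤ) ≃+ (Fin 3 → ℤ)) :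
    IsIso (s.pullback φ) s φ :=
  ⟨by simp [pullback], fun x y => by simp [pullback]⟩

theorem equivalence_ringStructIso : Equivalence RingStructIso where
  refl s := ⟨_, IsIso.refl s⟩
  symm := fun ⟨_, h⟩ => ⟨_, IsIso.symm h⟩
  trans := fun ⟨_, h⟩ ⟨_, k⟩ => ⟨_, IsIso.trans h k⟩

theorem _root_.RingStructIso.isDomainStruct (h : RingStructIso s t) (hs : IsDomainStruct s) :
    IsDomainStruct t := by
  obtain ⟨φ, hφ⟩ := h
  have hψ := IsIso.symm hφ
  refine ⟨fun h0 => hs.1 ?_, fun x y hxy => ?_⟩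
  · rw [← hψ.1, h0, map_zero]
  · have := hψ.2 x y
    rw [hxy, map_zero] at this
    simpa using hs.2 _ _ this.symm

theorem ringTrace_eq_trace (s : CubicRingStruct) (x : Fin 3 → ℤ) :
    ringTrace s x = LinearMap.trace ℤ _ (s.mulLin x) := by
  rw [LinearMap.trace_eq_matrix_trace ℤ (Pi.basisFun ℤ (Fin 3))]
  simp [ringTrace, Matrix.trace]

theorem IsIso.ringTrace_eq (h : IsIso s t φ) (x : Fin 3 → ℤ) :
    ringTrace t (φ x) = ringTrace s x := by
  rw [ringTrace_eq_trace, ringTrace_eq_trace,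
    ← LinearMap.trace_conj' (s.mulLin x) φ.toIntLinearEquiv]
  congr 1
  refine LinearMap.ext fun y => ?_
  simp [LinearEquiv.conj_apply, h.2]

/-- The trace form of a cubic ring. -/
noncomputable def traceForm (s : CubicRingStruct) : LinearMap.BilinForm ℤ (Fin 3 → ℤ) :=
  s.mulLin.compr₂ (LinearMap.trace ℤ _ ∘ₗ s.mulLin)

theorem traceForm_apply (s : CubicRingStruct) (x y : Fin 3 → ℤ) :
    s.traceForm x y = ringTrace s (s.mul x y) := by
  simp [traceForm, ringTrace_eq_trace]

theorem ringDisc_eq_det (s : CubicRingStruct) :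
    ringDisc s = (LinearMap.BilinForm.toMatrix' s.traceForm).det := by
  unfold ringDisc
  congr 1
  ext i j
  simp [LinearMap.BilinForm.toMatrix'_apply, traceForm_apply]

theorem _root_.RingStructIso.ringDisc_eq (h : RingStructIso s t) : ringDisc s = ringDisc t := by
  obtain ⟨φ, hφ⟩ := h
  have hφ : IsIso s t φ := hφ
  have hB : s.traceForm = t.traceForm.comp (φ.toIntLinearEquiv : (Fin 3 → ℤ) →ₗ[ℤ] _)
      (φ.toIntLinearEquiv : (Fin 3 → ℤ) →ₗ[ℤ] _) := by
    refine LinearMap.ext₂ fun x y => ?_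
    simp [LinearMap.BilinForm.comp_apply, traceForm_apply, ← hφ.2, hφ.ringTrace_eq]
  rw [ringDisc_eq_det, ringDisc_eq_det, hB, LinearMap.BilinForm.toMatrix'_comp]
  have hu := LinearEquiv.isUnit_det' φ.toIntLinearEquiv
  rw [← LinearMap.det_toMatrix'] at hu
  rw [Matrix.det_mul, Matrix.det_mul, Matrix.det_transpose]
  rcases Int.isUnit_iff.1 hu with h | h <;> simp [h]

theorem mul_apply_of_one_eq (h1 : s.one = ![1, 0, 0]) (x y : Fin 3 → ℤ) (i : Fin 3) :
    s.mul x y i = x 0 * y 0 * ![1, 0, 0] i + (x 0 * y 1 + x 1 * y 0) * ![0, 1, 0] i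
      + (x 0 * y 2 + x 2 * y 0) * ![0, 0, 1] i + x 1 * y 1 * s.mul ![0, 1, 0] ![0, 1, 0] i
      + (x 1 * y 2 + x 2 * y 1) * s.mul ![0, 1, 0] ![0, 0, 1] i
      + x 2 * y 2 * s.mul ![0, 0, 1] ![0, 0, 1] i := by
  have ex : ∀ x : Fin 3 → ℤ, x = x 0 • ![1, 0, 0] + x 1 • ![0, 1, 0] + x 2 • ![0, 0, 1] := by
    intro x
    ext i
    fin_cases i <;> simp
  have e0 : ∀ x, s.mul ![1, 0, 0] x = x := h1 ▸ s.one_mul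
  have e0' : ∀ x, s.mul x ![1, 0, 0] = x := fun x => by rw [s.mul_comm, e0]
  conv_lhs => rw [ex x, ex y]
  simp only [s.left_distrib, s.right_distrib, s.mul_smul, s.smul_mul, e0, e0',
    s.mul_comm ![0, 0, 1] ![0, 1, 0], Pi.add_apply, Pi.smul_apply, smul_eq_mul]
  ring

end CubicRingStruct

/-- The cubic ring attached to a binary cubic form, with basis `1, ω, θ` satisfying
`ω² = -ac + bω - aθ`, `ωθ = -ad`, `θ² = -bd + dω - cθ`. -/
def formRing (f : BinaryCubic) : CubicRingStruct where
  mul x y :=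
    ![x 0 * y 0 - f.1 * f.2.2.1 * (x 1 * y 1) - f.1 * f.2.2.2 * (x 1 * y 2 + x 2 * y 1)
        - f.2.1 * f.2.2.2 * (x 2 * y 2),
      x 0 * y 1 + x 1 * y 0 + f.2.1 * (x 1 * y 1) + f.2.2.2 * (x 2 * y 2),
      x 0 * y 2 + x 2 * y 0 - f.1 * (x 1 * y 1) - f.2.2.1 * (x 2 * y 2)]
  one := ![1, 0, 0]
  mul_comm x y := by
    ext i
    fin_cases i <;> simp <;> ring
  mul_assoc x y z := by
    ext i
    fin_cases i <;> simp <;> ring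
  one_mul x := by
    ext i
    fin_cases i <;> simp
  left_distrib x y z := by
    ext i
    fin_cases i <;> simp <;> ring

theorem ringDisc_formRing (f : BinaryCubic) : ringDisc (formRing f) = discF f := by
  obtain ⟨a, b, c, d⟩ := f
  simp [ringDisc, ringTrace, formRing, discF, Matrix.det_fin_three, Fin.sum_univ_three]
  ring

namespace CubicRingStruct

variable {s : CubicRingStruct}

theorem exists_eq_formRing (h1 : s.one = ![1, 0, 0])
    (h12 : s.mul ![0, 1, 0] ![0, 0, 1] 1 = 0) (h21 : s.mul ![0, 1, 0] ![0, 0, 1] 2 = 0) :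
    ∃ f, ∀ x y, s.mul x y = (formRing f).mul x y := by
  have A := fun i => congrFun (s.mul_assoc ![0, 1, 0] ![0, 1, 0] ![0, 0, 1]) i
  have B := fun i => congrFun (s.mul_assoc ![0, 1, 0] ![0, 0, 1] ![0, 0, 1]) i
  have hm := mul_apply_of_one_eq h1
  set p := s.mul ![0, 1, 0] ![0, 1, 0]
  set q := s.mul ![0, 1, 0] ![0, 0, 1]
  set r := s.mul ![0, 0, 1] ![0, 0, 1]
  simp only [hm p, hm _ q] at A
  simp only [hm q, hm _ r] at B
  have A1 := A 1
  have A2 := A 2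
  have B1 := B 1
  have B2 := B 2
  simp [h12, h21] at A1 A2 B1 B2
  refine ⟨(-p 2, p 1, -r 2, r 1), fun x y => funext fun i => ?_⟩
  rw [hm x y]
  fin_cases i <;> simp [formRing, h12, h21]
  · linear_combination (x 1 * y 1) * A2 + (x 1 * y 2 + x 2 * y 1) * B2 - (x 2 * y 2) * B1
  · ring
  · ring

end CubicRingStruct

/-- The additive automorphism of `ℤ³` given by a unimodular matrix. -/
noncomputable def Matrix.toAddEquivOfIsUnitDet (M : Matrix (Fin 3) (Fin 3) ℤ) (h : IsUnit M.det) :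
    (Fin 3 → ℤ) ≃+ (Fin 3 → ℤ) :=
  (Matrix.toLinearEquiv (Pi.basisFun ℤ (Fin 3)) M h).toAddEquiv

@[simp]
theorem Matrix.toAddEquivOfIsUnitDet_apply (M : Matrix (Fin 3) (Fin 3) ℤ) (h : IsUnit M.det)
    (x : Fin 3 → ℤ) : M.toAddEquivOfIsUnitDet h x = M.mulVec x := by
  simp [Matrix.toAddEquivOfIsUnitDet, Matrix.toLin_eq_toLin']

namespace CubicRingStruct

variable {s : CubicRingStruct}

theorem exists_isIso_formRing (h1 : s.one = ![1, 0, 0]) :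
    ∃ f φ, IsIso (formRing f) s φ ∧ ∀ x, φ x 1 = x 1 ∧ φ x 2 = x 2 := by
  set q := s.mul ![0, 1, 0] ![0, 0, 1] with hq
  have hdet : IsUnit (!![1, -q 2, -q 1; 0, 1, 0; 0, 0, 1] : Matrix (Fin 3) (Fin 3) ℤ).det := by
    simp [Matrix.det_fin_three]
  set φ := Matrix.toAddEquivOfIsUnitDet _ hdet
  have hφ : ∀ x, φ x = ![x 0 - q 2 * x 1 - q 1 * x 2, x 1, x 2] := by
    intro x
    ext i
    fin_cases i <;> simp [φ, Matrix.mulVec, dotProduct, Fin.sum_univ_three]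
    ring
  have hiso := isIso_pullback s φ
  have hone : (s.pullback φ).one = ![1, 0, 0] := by
    apply φ.injective
    rw [hiso.1, h1, hφ]
    simp
  have hmul := hiso.2 ![0, 1, 0] ![0, 0, 1]
  rw [hφ, hφ ![0, 1, 0], hφ ![0, 0, 1]] at hmul
  have m1 := congrFun hmul 1
  have m2 := congrFun hmul 2
  rw [mul_apply_of_one_eq h1, ← hq] at m1 m2
  simp at m1 m2
  obtain ⟨f, hf⟩ := exists_eq_formRing hone m1 m2
  refine ⟨f, φ, ⟨(congrArg φ hone.symm).trans hiso.1, fun x y => ?_⟩, fun x => by simp [hφ]⟩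
  rw [← hf, hiso.2]

theorem exists_isUnit_det_mulVec_eq_one (s : CubicRingStruct) :
    ∃ M : Matrix (Fin 3) (Fin 3) ℤ, IsUnit M.det ∧ M.mulVec ![1, 0, 0] = s.one := by
  obtain ⟨b, c, hb, hc, hbc⟩ := extract_gcd (s.one 1) (s.one 2)
  set g := gcd (s.one 1) (s.one 2)
  obtain ⟨a, g', ha, hg, -⟩ := extract_gcd (s.one 0) g
  have hunit : IsUnit (gcd (s.one 0) g) := by
    set k := gcd (s.one 0) g
    have hk : s.one = k • ![a, g' * b, g' * c] := by
      ext i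
      fin_cases i
      · simpa using ha
      · simp only [Fin.mk_one, hb, Pi.smul_apply, smul_eq_mul]
        simp
        linear_combination b * hg
      · simp only [Fin.reduceFinMk, hc, Pi.smul_apply, smul_eq_mul]
        simp
        linear_combination c * hg
    have h := congrFun (s.one_mul ![1, 0, 0]) 0
    rw [hk, s.smul_mul] at h
    exact IsUnit.of_mul_eq_one _ (by simpa using h)
  obtain ⟨m, n, hmn⟩ := (gcd_isUnit_iff _ _).1 hunit
  obtain ⟨r, t, hrt⟩ := (gcd_isUnit_iff _ _).1 hbc
  refine ⟨!![s.one 0, -n, 0; g * b, m * b, -t; g * c, m * c, r], ?_, ?_⟩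
  · have : (!![s.one 0, -n, 0; g * b, m * b, -t; g * c, m * c, r] :
        Matrix (Fin 3) (Fin 3) ℤ).det = 1 := by
      simp [Matrix.det_fin_three]
      linear_combination (m * s.one 0 + n * g) * hrt + hmn
    rw [this]
    exact isUnit_one
  · ext i
    fin_cases i <;> simp [Matrix.mulVec, dotProduct, Fin.sum_univ_three, ← hb, ← hc]

theorem exists_ringStructIso_formRing (s : CubicRingStruct) :
    ∃ f, RingStructIso (formRing f) s := by
  obtain ⟨M, hM, hone⟩ := s.exists_isUnit_det_mulVec_eq_one
  have hiso := isIso_pullback s (M.toAddEquivOfIsUnitDet hM)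
  obtain ⟨f, φ, hφ, -⟩ := exists_isIso_formRing (s := s.pullback (M.toAddEquivOfIsUnitDet hM)) (by
    apply (M.toAddEquivOfIsUnitDet hM).injective
    rw [hiso.1, Matrix.toAddEquivOfIsUnitDet_apply, hone])
  exact ⟨f, _, hφ.trans hiso⟩

variable {f g : BinaryCubic} {φ : (Fin 3 → ℤ) ≃+ (Fin 3 → ℤ)}

theorem IsIso.map_apply (h : IsIso (formRing g) (formRing f) φ) (x : Fin 3 → ℤ) (i : Fin 3) :
    φ x i = x 0 * ![1, 0, 0] i + x 1 * φ ![0, 1, 0] i + x 2 * φ ![0, 0, 1] i := by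
  have ex : x = x 0 • ![1, 0, 0] + x 1 • ![0, 1, 0] + x 2 • ![0, 0, 1] := by
    ext i
    fin_cases i <;> simp
  have h1 : φ ![1, 0, 0] = ![1, 0, 0] := h.1
  conv_lhs => rw [ex]
  simp only [map_add, map_zsmul, h1, Pi.add_apply, Pi.smul_apply, smul_eq_mul]

theorem IsIso.actsTo (h : IsIso (formRing g) (formRing f) φ) :
    ActsTo !![φ ![0, 1, 0] 1, φ ![0, 1, 0] 2; φ ![0, 0, 1] 1, φ ![0, 0, 1] 2] f g := by
  rw [actsTo_iff]
  intro x y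
  have hsq := h.2 ![0, x, y] ![0, x, y]
  have h1 := congrFun hsq 1
  have h2 := congrFun hsq 2
  rw [h.map_apply] at h1 h2
  simp [formRing, h.map_apply ![0, x, y]] at h1 h2
  simp [formEval, Matrix.det_fin_two]
  set p := φ ![0, 1, 0]
  set q := φ ![0, 0, 1]
  linear_combination (x * p 2 + y * q 2) * h1 - (x * p 1 + y * q 1) * h2

theorem IsIso.isUnit_det (h : IsIso (formRing g) (formRing f) φ) : IsUnit
    (!![φ ![0, 1, 0] 1, φ ![0, 1, 0] 2; φ ![0, 0, 1] 1, φ ![0, 0, 1] 2] :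
      Matrix (Fin 2) (Fin 2) ℤ).det := by
  have hu := LinearEquiv.isUnit_det' φ.toIntLinearEquiv
  rw [← LinearMap.det_toMatrix', Matrix.det_fin_three] at hu
  have e0 : Pi.single (0 : Fin 3) (1 : ℤ) = ![1, 0, 0] := by ext i; fin_cases i <;> simp
  have e1 : Pi.single (1 : Fin 3) (1 : ℤ) = ![0, 1, 0] := by ext i; fin_cases i <;> simp
  have e2 : Pi.single (2 : Fin 3) (1 : ℤ) = ![0, 0, 1] := by ext i; fin_cases i <;> simp
  have h1 : φ ![1, 0, 0] = ![1, 0, 0] := h.1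
  simp [LinearMap.toMatrix'_apply, e0, e1, e2, h1] at hu
  rwa [Matrix.det_fin_two_of, _root_.mul_comm (φ ![0, 1, 0] 2)]

theorem formEquiv_iff : FormEquiv f g ↔ RingStructIso (formRing g) (formRing f) := by
  constructor
  · rintro ⟨γ, hγ, hact⟩
    have hdet : (!![1, 0, 0; 0, γ 0 0, γ 1 0; 0, γ 0 1, γ 1 1] :
        Matrix (Fin 3) (Fin 3) ℤ).det = γ.det := by
      simp [Matrix.det_fin_three, Matrix.det_fin_two]
      ring
    set φ := Matrix.toAddEquivOfIsUnitDet _ (hdet ▸ hγ)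
    have hφ : ∀ x, φ x = ![x 0, γ 0 0 * x 1 + γ 1 0 * x 2, γ 0 1 * x 1 + γ 1 1 * x 2] := by
      intro x
      ext i
      fin_cases i <;> simp [φ, Matrix.mulVec, dotProduct, Fin.sum_univ_three]
    have hiso := isIso_pullback (formRing f) φ
    obtain ⟨g', ψ, hψ, hψx⟩ := exists_isIso_formRing (s := (formRing f).pullback φ) (by
      apply φ.injective
      rw [hiso.1, hφ]
      simp [formRing])
    have htrans := hψ.trans hiso
    have hact' := htrans.actsTo
    simp only [AddEquiv.trans_apply, hφ, (hψx _).1, (hψx _).2] at hact'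
    have hγ' : γ = !![γ 0 0, γ 0 1; γ 1 0, γ 1 1] := Matrix.eta_fin_two γ
    simp at hact'
    rw [← hγ'] at hact'
    rw [actsTo_iff] at hact hact'
    have : g' = g := formEval_injective fun x y =>
      mul_left_cancel₀ hγ.ne_zero ((hact' x y).trans (hact x y).symm)
    exact ⟨_, this ▸ htrans⟩
  · rintro ⟨φ, hφ⟩
    have hφ : IsIso (formRing g) (formRing f) φ := hφ
    exact ⟨_, hφ.isUnit_det, hφ.actsTo⟩

end CubicRingStruct

theorem isDomainStruct_formRing {f : BinaryCubic}
    (h : ∀ p q, formEval f p q = 0 → p = 0 ∧ q = 0) : IsDomainStruct (formRing f) := by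
  refine ⟨fun h0 => by simpa [formRing] using congrFun h0 0, fun x y hxy => ?_⟩
  obtain ⟨a, b, c, d⟩ := f
  have E0 := congrFun hxy 0
  have E1 := congrFun hxy 1
  have E2 := congrFun hxy 2
  simp [formRing] at E0 E1 E2
  have hprod : formEval (a, b, c, d) (x 1) (x 2) * formEval (a, b, c, d) (y 1) (y 2) = 0 := by
    -- By Cramer's rule `D • x = α • 1 + β • y + γ • y²`, and `x * y = 0`.
    set Y0 := y 0 * y 0 - a * c * (y 1 * y 1) - a * d * (2 * y 1 * y 2) - b * d * (y 2 * y 2)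
      with hY0
    set Y1 := 2 * y 0 * y 1 + b * (y 1 * y 1) + d * (y 2 * y 2) with hY1
    set Y2 := 2 * y 0 * y 2 - a * (y 1 * y 1) - c * (y 2 * y 2) with hY2
    set X1 := 2 * x 0 * x 1 + b * (x 1 * x 1) + d * (x 2 * x 2) with hX1
    set X2 := 2 * x 0 * x 2 - a * (x 1 * x 1) - c * (x 2 * x 2) with hX2
    set D := y 1 * Y2 - y 2 * Y1 with hD
    set β := x 1 * Y2 - x 2 * Y1 with hβ
    set γ := y 1 * x 2 - y 2 * x 1 with hγ
    set α := D * x 0 - β * y 0 - γ * Y0 with hα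
    have k1 : D * X1 = α * x 1 := by
      simp only [hα, hβ, hγ, hD, hX1, hY0, hY1, hY2]
      linear_combination (γ * y 1) * E0 + (β + γ * y 0 + b * γ * y 1) * E1 + d * γ * y 2 * E2
    have k2 : D * X2 = α * x 2 := by
      simp only [hα, hβ, hγ, hD, hX2, hY0, hY1, hY2]
      linear_combination (γ * y 2) * E0 + (β + γ * y 0 - c * γ * y 2) * E2 - a * γ * y 1 * E1
    have hDf : D = -formEval (a, b, c, d) (y 1) (y 2) := by
      simp only [hD, hY1, hY2, formEval]
      ring
    have hXf : x 1 * X2 - x 2 * X1 = -formEval (a, b, c, d) (x 1) (x 2) := by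
      simp only [hX1, hX2, formEval]
      ring
    linear_combination x 1 * k2 - x 2 * k1 - hXf * D +
      formEval (a, b, c, d) (x 1) (x 2) * hDf
  have key : ∀ x y : Fin 3 → ℤ, (formRing (a, b, c, d)).mul x y = 0 → x 1 = 0 → x 2 = 0 →
      x = 0 ∨ y = 0 := by
    intro x y hxy h1 h2
    have E0 := congrFun hxy 0
    have E1 := congrFun hxy 1
    have E2 := congrFun hxy 2
    simp [formRing, h1, h2] at E0 E1 E2
    by_cases h0 : x 0 = 0
    · left
      ext i
      fin_cases i <;> assumption
    · right
      ext i
      fin_cases i <;> simp_all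
  rcases mul_eq_zero.1 hprod with h0 | h0
  · obtain ⟨h1, h2⟩ := h _ _ h0
    exact key x y hxy h1 h2
  · obtain ⟨h1, h2⟩ := h _ _ h0
    rw [(formRing _).mul_comm] at hxy
    exact (key y x hxy h1 h2).symm

theorem IsDomainStruct.eq_zero_of_formEval_eq_zero {f : BinaryCubic}
    (h : IsDomainStruct (formRing f)) {p q : ℤ} (hpq : formEval f p q = 0) : p = 0 ∧ q = 0 := by
  obtain ⟨a, b, c, d⟩ := f
  simp only [formEval] at hpq
  by_cases hp : p = 0
  · subst hp
    refine ⟨rfl, ?_⟩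
    by_contra hq
    have hd : d = 0 := by simpa [hq] using hpq
    have := h.2 ![0, 0, 1] ![c, 0, 1] (by
      ext i
      fin_cases i <;> simp [formRing, hd])
    rcases this with h | h <;> simpa using congrFun h 2
  · exfalso
    -- The element `p(pω + qθ)` has all its eigenvalues in `ℤ`.
    have := h.2 ![p * q * c + q ^ 2 * d, p ^ 2, p * q]
      ![-(b * p ^ 2 + 2 * d * q ^ 2 + p * q * c), p ^ 2, p * q] (by
        ext i
        fin_cases i <;> simp [formRing]
        · linear_combination -(c * p + 2 * d * q) * hpq
        · ring
        · linear_combination -p * hpq)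
    rcases this with h | h <;> simpa [hp] using congrFun h 1

theorem eq_zero_of_irreducible_toPoly {K : Type*} [Field K] {f : K × K × K × K}
    (h : Irreducible (toPoly f)) {p q : K} (hpq : formEval f p q = 0) : p = 0 ∧ q = 0 := by
  have key : ∀ L Q : MvPolynomial (Fin 2) K, toPoly f = L * Q →
      MvPolynomial.eval ![p, q] L = 0 → MvPolynomial.eval ![0, 0] Q = 0 → False := by
    intro L Q hLQ hL hQ
    rcases h.isUnit_or_isUnit hLQ with hu | hu
    · simpa [hL] using hu.map (MvPolynomial.eval ![p, q])
    · simpa [hQ] using hu.map (MvPolynomial.eval ![0, 0])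
  obtain ⟨a, b, c, d⟩ := f
  simp only [formEval] at hpq
  by_contra! hne
  open MvPolynomial in
  by_cases hp : p = 0
  · have hq := hne hp
    subst hp
    have hd : d = 0 := by simpa [hq] using hpq
    refine key (X 0) (C a * X 0 ^ 2 + C b * X 0 * X 1 + C c * X 1 ^ 2) ?_ (by simp) (by simp)
    simp [toPoly, hd]
    ring
  · refine key (C q * X 0 - C p * X 1) (C (-d / p) * X 1 ^ 2 + C (-(c * p + d * q) / p ^ 2) * X 0 * X 1
      + C (-(b * p ^ 2 + c * p * q + d * q ^ 2) / p ^ 3) * X 0 ^ 2) ?_ (by simp; ring) (by simp)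
    have ha : a = -(b * p ^ 2 * q + c * p * q ^ 2 + d * q ^ 3) / p ^ 3 := by
      field_simp
      linear_combination hpq
    have e1 : a = q * (-(b * p ^ 2 + c * p * q + d * q ^ 2) / p ^ 3) := by
      rw [ha]; ring
    have e2 : b = q * (-(c * p + d * q) / p ^ 2) -
        p * (-(b * p ^ 2 + c * p * q + d * q ^ 2) / p ^ 3) := by
      field_simp; ring
    have e3 : c = q * (-d / p) - p * (-(c * p + d * q) / p ^ 2) := by
      field_simp; ring
    have e4 : d = - (p * (-d / p)) := by field_simp
    replace e1 := congrArg (C (σ := Fin 2)) e1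
    replace e2 := congrArg (C (σ := Fin 2)) e2
    replace e3 := congrArg (C (σ := Fin 2)) e3
    replace e4 := congrArg (C (σ := Fin 2)) e4
    simp only [C_mul, C_sub, C_neg] at e1 e2 e3 e4
    simp only [toPoly]
    linear_combination X 0 ^ 3 * e1 + X 0 ^ 2 * X 1 * e2 + X 0 * X 1 ^ 2 * e3 + X 1 ^ 3 * e4

theorem irreducible_toPoly {K : Type*} [Field K] {f : K × K × K × K}
    (h : ∀ p q, formEval f p q = 0 → p = 0 ∧ q = 0) : Irreducible (toPoly f) := by
  obtain ⟨a, b, c, d⟩ := f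
  have ha : a ≠ 0 := by
    rintro rfl
    simpa using (h 1 0 (by simp [formEval])).1
  set ev : MvPolynomial (Fin 2) K →ₐ[K] Polynomial K :=
    MvPolynomial.aeval ![Polynomial.X, 1] with hev
  have hdeg : ∀ A : MvPolynomial (Fin 2) K, (ev A).natDegree ≤ A.totalDegree := by
    intro A
    have := MvPolynomial.aeval_natDegree_le (m := A.totalDegree) (n := 1) A le_rfl
      ![Polynomial.X, 1] (by intro i; fin_cases i <;> simp)
    simpa using this
  have hevf : ev (toPoly (a, b, c, d)) = Polynomial.C a * Polynomial.X ^ 3 +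
      Polynomial.C b * Polynomial.X ^ 2 + Polynomial.C c * Polynomial.X + Polynomial.C d := by
    simp [hev, toPoly]
  have hevdeg : (ev (toPoly (a, b, c, d))).natDegree = 3 := by
    rw [hevf, Polynomial.natDegree_cubic ha]
  have htot : (toPoly (a, b, c, d)).totalDegree ≤ 3 := by
    refine MvPolynomial.IsHomogeneous.totalDegree_le ?_
    have hX : ∀ i : Fin 2, (MvPolynomial.X i : MvPolynomial (Fin 2) K).IsHomogeneous 1 :=
      MvPolynomial.isHomogeneous_X K
    have hC : ∀ r : K, (MvPolynomial.C r : MvPolynomial (Fin 2) K).IsHomogeneous 0 :=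
      MvPolynomial.isHomogeneous_C _
    exact ((((hC a).mul ((hX 0).pow 3)).add (((hC b).mul ((hX 0).pow 2)).mul (hX 1))).add
      (((hC c).mul (hX 0)).mul ((hX 1).pow 2))).add ((hC d).mul ((hX 1).pow 3))
  have hirr : Irreducible (ev (toPoly (a, b, c, d))) := by
    refine Polynomial.irreducible_of_degree_le_three_of_not_isRoot (by simp [hevdeg]) ?_
    intro x hx
    rw [hevf] at hx
    refine one_ne_zero (h x 1 ?_).2
    simpa [formEval, Polynomial.IsRoot] using hx
  have key : ∀ A B : MvPolynomial (Fin 2) K, toPoly (a, b, c, d) = A * B → IsUnit (ev A) →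
      IsUnit A := by
    intro A B hAB hA
    have hne : toPoly (a, b, c, d) ≠ 0 := by
      intro h0
      simp [h0] at hevdeg
    have hA0 : A ≠ 0 := by rintro rfl; simp [hAB] at hne
    have hB0 : B ≠ 0 := by rintro rfl; simp [hAB] at hne
    rw [hAB, MvPolynomial.totalDegree_mul_of_isDomain hA0 hB0] at htot
    rw [hAB, map_mul, Polynomial.natDegree_mul hA.ne_zero
      (fun h0 => by simp [h0] at hevdeg), Polynomial.natDegree_eq_zero_of_isUnit hA] at hevdeg
    have hB := hdeg B
    have hA' : A.totalDegree = 0 := by omega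
    rw [MvPolynomial.totalDegree_eq_zero_iff_eq_C] at hA'
    rw [hA'] at hA0 ⊢
    exact (IsUnit.mk0 _ fun h0 => hA0 (by rw [h0, map_zero])).map MvPolynomial.C
  refine ⟨fun hu => hirr.not_isUnit (hu.map ev), fun A B hAB => ?_⟩
  rcases hirr.isUnit_or_isUnit (by rw [hAB, map_mul]) with hu | hu
  · exact Or.inl (key A B hAB hu)
  · exact Or.inr (key B A (by rw [hAB, mul_comm]) hu)

theorem irredForm_iff (f : BinaryCubic) :
    IrredForm f ↔ ∀ p q, formEval f p q = 0 → p = 0 ∧ q = 0 := by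
  have hmap : MvPolynomial.map (Int.castRingHom ℚ) (toPoly f) =
      toPoly ((f.1 : ℚ), (f.2.1 : ℚ), (f.2.2.1 : ℚ), (f.2.2.2 : ℚ)) := by
    simp [toPoly]
  rw [IrredForm, hmap]
  constructor
  · intro h p q hpq
    have := eq_zero_of_irreducible_toPoly h (p := p) (q := q) (by
      simp only [formEval] at hpq ⊢
      exact_mod_cast hpq)
    exact_mod_cast this
  · intro h
    refine irreducible_toPoly fun p q hpq => ?_
    have hp := Rat.num_div_den p
    have hq := Rat.num_div_den q
    have hp0 : (p.den : ℚ) ≠ 0 := by exact_mod_cast p.den_nz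
    have hq0 : (q.den : ℚ) ≠ 0 := by exact_mod_cast q.den_nz
    have := h (p.num * q.den) (q.num * p.den) (by
      have e1 : (p.num : ℚ) = p * p.den := by rw [← div_eq_iff hp0, hp]
      have e2 : (q.num : ℚ) = q * q.den := by rw [← div_eq_iff hq0, hq]
      have : formEval ((f.1 : ℚ), (f.2.1 : ℚ), (f.2.2.1 : ℚ), (f.2.2.2 : ℚ))
          (p.num * q.den) (q.num * p.den) = 0 := by
        rw [e1, e2]
        simp only [formEval] at hpq ⊢
        linear_combination (p.den * q.den : ℚ) ^ 3 * hpq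
      simp only [formEval] at this ⊢
      exact_mod_cast this)
    simpa using this

theorem irredForm_iff_isDomainStruct (f : BinaryCubic) :
    IrredForm f ↔ IsDomainStruct (formRing f) := by
  rw [irredForm_iff]
  exact ⟨isDomainStruct_formRing, fun h _ _ => h.eq_zero_of_formEval_eq_zero⟩

theorem delone_faddeev :
    ∃ Φ : Quot FormEquiv ≃ Quot RingStructIso,
      ∀ (f : BinaryCubic) (s : CubicRingStruct),
        Φ (Quot.mk _ f) = Quot.mk _ s →
          ringDisc s = discF f ∧ (IrredForm f ↔ IsDomainStruct s) := by
  have hequiv := CubicRingStruct.equivalence_ringStructIso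
  let Ψ : Quot FormEquiv → Quot RingStructIso :=
    Quot.map formRing fun _ _ h => hequiv.symm (CubicRingStruct.formEquiv_iff.1 h)
  have hexact : ∀ s t, Quot.mk RingStructIso s = Quot.mk RingStructIso t → RingStructIso s t :=
    fun s t h => (hequiv.eqvGen_iff).1 (Quot.eqvGen_exact h)
  have hΨ : Function.Bijective Ψ := by
    constructor
    · rintro ⟨f⟩ ⟨g⟩ h
      exact Quot.sound (CubicRingStruct.formEquiv_iff.2 (hequiv.symm (hexact _ _ h)))
    · rintro ⟨s⟩
      obtain ⟨f, hf⟩ := s.exists_ringStructIso_formRing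
      exact ⟨Quot.mk _ f, Quot.sound hf⟩
  refine ⟨Equiv.ofBijective Ψ hΨ, fun f s h => ?_⟩
  have hiso : RingStructIso (formRing f) s := hexact _ _ h
  rw [irredForm_iff_isDomainStruct, ← ringDisc_formRing, hiso.ringDisc_eq]
  exact ⟨rfl, hiso.isDomainStruct, (hequiv.symm hiso).isDomainStruct⟩
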